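/- Let I be a finite nonempty set of intervals with pairwise distinct finishing times. Then the maximum number of vertices on a path in the compatibility forest F(I) (i.e., the maximum k such that there exist i₁, …, i_k ∈ I with i_{t+1} = rc(i_t) for all t) equals the maximum cardinality of a compatible set of I; in particular the longest paths in F(I) correspond to optimal sets, and the path starting from the ≼-least interval is the greedy optimal set. -/

import Mathlib

/-- Two intervals (given as pairs (start, finish)) are compatible if one
finishes strictly before the other starts. -/
def Compatible (i j : ℝ × ℝ) : Prop := i.2 < j.1 ∨ j.2 < i.1

/-- `j` is the right compatible interval of `i` in `I`: the ≼-least element of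
`I` compatible with `i` and strictly after `i` in the ordering by finishing time. -/
def IsRC (I : Finset (ℝ × ℝ)) (i j : ℝ × ℝ) : Prop :=
  j ∈ I ∧ i.2 < j.2 ∧ Compatible i j ∧
    ∀ k ∈ I, i.2 < k.2 → Compatible i k → j.2 ≤ k.2

/-- `m` is the ≼-least interval of `I` (ordering by finishing time). -/
def IsLeastInterval (I : Finset (ℝ × ℝ)) (m : ℝ × ℝ) : Prop :=
  m ∈ I ∧ ∀ j ∈ I, m.2 ≤ j.2

/-- Membership in the greedy optimal set of `I`. -/
inductive InGreedy (I : Finset (ℝ × ℝ)) : ℝ × ℝ → Prop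
  | base (m : ℝ × ℝ) : IsLeastInterval I m → InGreedy I m
  | step (i j : ℝ × ℝ) : InGreedy I i → IsRC I i j → InGreedy I j

section

variable {I : Finset (ℝ × ℝ)}

theorem IsRC.finish_lt_start {i j : ℝ × ℝ} (hval : ∀ i ∈ I, i.1 < i.2) (hi : i ∈ I)
    (h : IsRC I i j) : i.2 < j.1 := by
  obtain ⟨-, hlt, hc | hc, -⟩ := h
  · exact hc
  · exact absurd (hval i hi) (by linarith)

theorem InGreedy.mem {i : ℝ × ℝ} (h : InGreedy I i) : i ∈ I := by
  cases h with
  | base _ h => exact h.1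
  | step _ _ _ h => exact h.1

theorem IsRC.rightUnique (hdist : ∀ i ∈ I, ∀ j ∈ I, i.2 = j.2 → i = j) :
    Relator.RightUnique (IsRC I) := by
  intro i j k hj hk
  exact hdist j hj.1 k hk.1
    (le_antisymm (hj.2.2.2 k hk.1 hk.2.1 hk.2.2.1) (hk.2.2.2 j hj.1 hj.2.1 hj.2.2.1))

theorem finish_lt_start_of_transGen (hval : ∀ i ∈ I, i.1 < i.2) {i j : ℝ × ℝ} (hi : i ∈ I)
    (h : Relation.TransGen (IsRC I) i j) : j ∈ I ∧ i.2 < j.1 := by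
  induction h with
  | single h => exact ⟨h.1, h.finish_lt_start hval hi⟩
  | tail _ h ih =>
    have := hval _ ih.1
    have := h.finish_lt_start hval ih.1
    exact ⟨h.1, by linarith [ih.2]⟩

theorem InGreedy.exists_least_reflTransGen {i : ℝ × ℝ} (h : InGreedy I i) :
    ∃ m, IsLeastInterval I m ∧ Relation.ReflTransGen (IsRC I) m i := by
  induction h with
  | base m hm => exact ⟨m, hm, .refl⟩
  | step i j _ h ih =>
    obtain ⟨m, hm, hmi⟩ := ih
    exact ⟨m, hm, hmi.tail h⟩

theorem InGreedy.finish_lt_start (hval : ∀ i ∈ I, i.1 < i.2)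
    (hdist : ∀ i ∈ I, ∀ j ∈ I, i.2 = j.2 → i = j) {i j : ℝ × ℝ}
    (hi : InGreedy I i) (hj : InGreedy I j) (hij : i.2 < j.2) : i.2 < j.1 := by
  obtain ⟨m, hm, hmi⟩ := hi.exists_least_reflTransGen
  obtain ⟨m', hm', hmj⟩ := hj.exists_least_reflTransGen
  obtain rfl : m = m' := hdist m hm.1 m' hm'.1 (le_antisymm (hm.2 _ hm'.1) (hm'.2 _ hm.1))
  rcases Relation.ReflTransGen.total_of_right_unique (IsRC.rightUnique hdist) hmi hmj with h | h
  · rcases Relation.reflTransGen_iff_eq_or_transGen.1 h with rfl | h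
    · exact absurd hij (lt_irrefl _)
    · exact (finish_lt_start_of_transGen hval hi.mem h).2
  · rcases Relation.reflTransGen_iff_eq_or_transGen.1 h with rfl | h
    · exact absurd hij (lt_irrefl _)
    · have := (finish_lt_start_of_transGen hval hj.mem h).2
      have := hval i hi.mem
      linarith

theorem InGreedy.compatible (hval : ∀ i ∈ I, i.1 < i.2)
    (hdist : ∀ i ∈ I, ∀ j ∈ I, i.2 = j.2 → i = j) {i j : ℝ × ℝ}
    (hi : InGreedy I i) (hj : InGreedy I j) (hij : i ≠ j) : Compatible i j := by
  rcases lt_trichotomy i.2 j.2 with h | h | h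
  · exact .inl (hi.finish_lt_start hval hdist hj h)
  · exact absurd (hdist i hi.mem j hj.mem h) hij
  · exact .inr (hj.finish_lt_start hval hdist hi h)

theorem exists_isRC_of_finish_lt_start {i k : ℝ × ℝ} (hk : k ∈ I) (hlt : k.1 < k.2)
    (hik : i.2 < k.1) : ∃ j, IsRC I i j ∧ j.2 ≤ k.2 := by
  classical
  obtain ⟨j, hj, hmin⟩ := (I.filter fun j => i.2 < j.2 ∧ Compatible i j).exists_min_image
    Prod.snd ⟨k, Finset.mem_filter.2 ⟨hk, hik.trans hlt, .inl hik⟩⟩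
  obtain ⟨hjI, hij, hc⟩ := Finset.mem_filter.1 hj
  exact ⟨j, ⟨hjI, hij, hc, fun l hl h h' => hmin l (Finset.mem_filter.2 ⟨hl, h, h'⟩)⟩,
    hmin k (Finset.mem_filter.2 ⟨hk, hik.trans hlt, .inl hik⟩)⟩

/-- Among the greedy intervals finishing no later than `x`, there is a last one. -/
theorem exists_last_inGreedy_le {x : ℝ × ℝ} (hx : x ∈ I) :
    ∃ g, InGreedy I g ∧ g.2 ≤ x.2 ∧ ∀ h, InGreedy I h → h.2 ≤ x.2 → h.2 ≤ g.2 := by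
  classical
  obtain ⟨m, hm, hmin⟩ := I.exists_min_image Prod.snd ⟨x, hx⟩
  obtain ⟨g, hg, hmax⟩ := (I.filter fun g => InGreedy I g ∧ g.2 ≤ x.2).exists_max_image
    Prod.snd ⟨m, Finset.mem_filter.2 ⟨hm, .base m ⟨hm, hmin⟩, hmin x hx⟩⟩
  obtain ⟨-, hg, hgx⟩ := Finset.mem_filter.1 hg
  exact ⟨g, hg, hgx, fun h hh hhx => hmax h (Finset.mem_filter.2 ⟨hh.mem, hh, hhx⟩)⟩

theorem setOf_inGreedy_finite (I : Finset (ℝ × ℝ)) : {i | InGreedy I i}.Finite :=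
  I.finite_toSet.subset fun _ h => h.mem

/-- Every compatible set is at most as large as the greedy set. -/
theorem card_le_ncard_inGreedy (hval : ∀ i ∈ I, i.1 < i.2) {K : Finset (ℝ × ℝ)} (hK : K ⊆ I)
    (hc : ∀ i ∈ K, ∀ j ∈ K, i ≠ j → Compatible i j) :
    K.card ≤ {i | InGreedy I i}.ncard := by
  choose! g hg hgle hgmax using fun x (hx : x ∈ I) => exists_last_inGreedy_le hx
  have key : ∀ x ∈ K, ∀ y ∈ K, x.2 < y.1 → (g x).2 < (g y).2 := by
    intro x hx y hy hxy
    obtain ⟨j, hj, hjy⟩ := exists_isRC_of_finish_lt_start (hK hy) (hval y (hK hy))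
      ((hgle x (hK hx)).trans_lt hxy)
    exact hj.2.1.trans_le (hgmax y (hK hy) j (.step _ _ (hg x (hK hx)) hj) hjy)
  rw [← Set.ncard_coe_finset]
  refine Set.ncard_le_ncard_of_injOn g (fun x hx => hg x (hK hx)) ?_ (setOf_inGreedy_finite I)
  intro x hx y hy hxy
  by_contra hne
  rcases hc x hx y hy hne with h | h
  · exact (key x hx y hy h).ne (by rw [hxy])
  · exact (key y hy x hx h).ne (by rw [hxy])

/-- The vertices of a path in the compatibility forest form a compatible set. -/
theorem exists_compatible_card_eq_of_path (hval : ∀ i ∈ I, i.1 < i.2) {k : ℕ} {v : ℕ → ℝ × ℝ}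
    (hv : ∀ t < k, v t ∈ I) (hrc : ∀ t, t + 1 < k → IsRC I (v t) (v (t + 1))) :
    ∃ K : Finset (ℝ × ℝ), K ⊆ I ∧
      (∀ i ∈ K, ∀ j ∈ K, i ≠ j → Compatible i j) ∧ K.card = k := by
  classical
  have key : ∀ s t, s < t → t < k → (v s).2 < (v t).1 := by
    intro s t hst
    induction t, hst using Nat.le_induction with
    | base => exact fun ht => (hrc s ht).finish_lt_start hval (hv s (by omega))
    | succ t hst ih =>
      intro ht
      have := ih (by omega)
      have := hval _ (hv t (by omega))
      have := (hrc t ht).finish_lt_start hval (hv t (by omega))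
      linarith
  refine ⟨(Finset.range k).image v, ?_, ?_, ?_⟩
  · intro x hx
    obtain ⟨t, ht, rfl⟩ := Finset.mem_image.1 hx
    exact hv t (Finset.mem_range.1 ht)
  · intro x hx y hy hxy
    obtain ⟨s, hs, rfl⟩ := Finset.mem_image.1 hx
    obtain ⟨t, ht, rfl⟩ := Finset.mem_image.1 hy
    rcases lt_trichotomy s t with h | rfl | h
    · exact .inl (key s t h (Finset.mem_range.1 ht))
    · exact absurd rfl hxy
    · exact .inr (key t s h (Finset.mem_range.1 hs))
  · rw [Finset.card_image_of_injOn, Finset.card_range]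
    intro s hs t ht hst
    have hs' : s < k := by simpa using hs
    have ht' : t < k := by simpa using ht
    have hvs := hval _ (hv s hs')
    rcases lt_trichotomy s t with h | h | h
    · have := key s t h ht'
      rw [← hst] at this
      linarith
    · exact h
    · have := key t s h hs'
      rw [← hst] at this
      linarith

/-- Each greedy interval ends a path through all greedy intervals up to it. -/
theorem InGreedy.exists_path (hval : ∀ i ∈ I, i.1 < i.2)
    (hdist : ∀ i ∈ I, ∀ j ∈ I, i.2 = j.2 → i = j) {g : ℝ × ℝ} (hg : InGreedy I g) :
    ∃ (n : ℕ) (v : ℕ → ℝ × ℝ), v n = g ∧ (∀ t < n + 1, v t ∈ I) ∧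
      (∀ t, t + 1 < n + 1 → IsRC I (v t) (v (t + 1))) ∧
      ∀ x, InGreedy I x → x.2 ≤ g.2 → ∃ t < n + 1, v t = x := by
  induction hg with
  | base m hm =>
    refine ⟨0, fun _ => m, rfl, fun _ _ => hm.1, fun t ht => by omega, fun x hx hxm => ?_⟩
    exact ⟨0, by omega, hdist m hm.1 x hx.mem (le_antisymm (hm.2 x hx.mem) hxm)⟩
  | step i j hi hij ih =>
    obtain ⟨n, v, hvn, hv, hrc, hcover⟩ := ih
    refine ⟨n + 1, fun t => if t ≤ n then v t else j, by simp, ?_, ?_, ?_⟩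
    · intro t ht
      by_cases h : t ≤ n
      · simpa [h] using hv t (by omega)
      · simpa [h] using hij.1
    · intro t ht
      rcases (show t < n ∨ t = n by omega) with h | rfl
      · simpa [h.le, Nat.succ_le_of_lt h] using hrc t (by omega)
      · simpa [hvn] using hij
    · intro x hx hxj
      rcases hxj.eq_or_lt with h | h
      · exact ⟨n + 1, by omega, by simpa using hdist j hij.1 x hx.mem h.symm⟩
      · have hxi : x.2 ≤ i.2 := by
          by_contra! hix
          exact absurd (hij.2.2.2 x hx.mem hix
            (.inl (hi.finish_lt_start hval hdist hx hix))) (not_le.2 h)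
        obtain ⟨t, ht, rfl⟩ := hcover x hx hxi
        exact ⟨t, by omega, by simp [Nat.lt_succ_iff.1 ht]⟩

/-- Some path in the compatibility forest has at least as many vertices as the greedy set. -/
theorem exists_path_ncard_inGreedy_le (hne : I.Nonempty) (hval : ∀ i ∈ I, i.1 < i.2)
    (hdist : ∀ i ∈ I, ∀ j ∈ I, i.2 = j.2 → i = j) :
    ∃ k, {i | InGreedy I i}.ncard ≤ k ∧ ∃ v : ℕ → ℝ × ℝ, (∀ t < k, v t ∈ I) ∧
      ∀ t, t + 1 < k → IsRC I (v t) (v (t + 1)) := by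
  classical
  obtain ⟨x, hx, hmax⟩ := I.exists_max_image Prod.snd hne
  obtain ⟨g, hg, -, hglast⟩ := exists_last_inGreedy_le hx
  obtain ⟨n, v, -, hv, hrc, hcover⟩ := hg.exists_path hval hdist
  refine ⟨n + 1, ?_, v, hv, hrc⟩
  have hsub : {i | InGreedy I i} ⊆ ((Finset.range (n + 1)).image v : Finset (ℝ × ℝ)) := by
    intro y hy
    obtain ⟨t, ht, rfl⟩ := hcover y hy (hglast y hy (hmax y (InGreedy.mem hy)))
    exact Finset.mem_coe.2 (Finset.mem_image_of_mem v (Finset.mem_range.2 ht))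
  calc _ ≤ _ := Set.ncard_le_ncard hsub (Finset.finite_toSet _)
    _ = _ := Set.ncard_coe_finset _
    _ ≤ _ := Finset.card_image_le
    _ = n + 1 := Finset.card_range _

end

/-- The maximum number of vertices on a path in the compatibility forest of `I`
equals the maximum cardinality of a compatible set of `I`; moreover the greedy
optimal set (the path starting from the ≼-least interval) achieves this maximum. -/
theorem longest_path_eq_max_compatible (I : Finset (ℝ × ℝ)) (hne : I.Nonempty)
    (hval : ∀ i ∈ I, i.1 < i.2)
    (hdist : ∀ i ∈ I, ∀ j ∈ I, i.2 = j.2 → i = j) :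
    sSup {k : ℕ | ∃ v : ℕ → ℝ × ℝ, (∀ t < k, v t ∈ I) ∧
        ∀ t, t + 1 < k → IsRC I (v t) (v (t + 1))}
      = sSup {c : ℕ | ∃ K : Finset (ℝ × ℝ), K ⊆ I ∧
          (∀ i ∈ K, ∀ j ∈ K, i ≠ j → Compatible i j) ∧ K.card = c} ∧
    {i | InGreedy I i}.ncard
      = sSup {c : ℕ | ∃ K : Finset (ℝ × ℝ), K ⊆ I ∧
          (∀ i ∈ K, ∀ j ∈ K, i ≠ j → Compatible i j) ∧ K.card = c} := by
  have hcompat : IsGreatest {c : ℕ | ∃ K : Finset (ℝ × ℝ), K ⊆ I ∧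
      (∀ i ∈ K, ∀ j ∈ K, i ≠ j → Compatible i j) ∧ K.card = c} {i | InGreedy I i}.ncard := by
    constructor
    · have hfin := setOf_inGreedy_finite I
      refine ⟨hfin.toFinset, fun i hi => ?_, fun i hi j hj => ?_,
        (Set.ncard_eq_toFinset_card _ hfin).symm⟩
      · exact InGreedy.mem (hfin.mem_toFinset.1 hi)
      · exact InGreedy.compatible hval hdist (hfin.mem_toFinset.1 hi) (hfin.mem_toFinset.1 hj)
    · rintro c ⟨K, hK, hc, rfl⟩
      exact card_le_ncard_inGreedy hval hK hc
  have hpath : IsGreatest {k : ℕ | ∃ v : ℕ → ℝ × ℝ, (∀ t < k, v t ∈ I) ∧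
      ∀ t, t + 1 < k → IsRC I (v t) (v (t + 1))} {i | InGreedy I i}.ncard := by
    have hub : ∀ k, (∃ v : ℕ → ℝ × ℝ, (∀ t < k, v t ∈ I) ∧
        ∀ t, t + 1 < k → IsRC I (v t) (v (t + 1))) → k ≤ {i | InGreedy I i}.ncard :=
      fun k ⟨_, hv, hrc⟩ => hcompat.2 (exists_compatible_card_eq_of_path hval hv hrc)
    obtain ⟨k, hk, hkpath⟩ := exists_path_ncard_inGreedy_le hne hval hdist
    exact ⟨hk.antisymm (hub k hkpath) ▸ hkpath, hub⟩
  rw [hpath.csSup_eq, hcompat.csSup_eq]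
  exact ⟨rfl, rfl⟩
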